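/- arXiv:math/0607102 — 6 statements merged into one kernel-verified Lean document; each statement's English description precedes it below -/
import Mathlib

section
/- Let σ be a conjugate-linear involution of g with σ(h) = h and σ*(Δ) = Δ. Then μ := σ*|_Δ is a diagram automorphism of order 1 or 2 of Δ (not depending on any choice of root vectors), and there exists a choice of root vectors e_α ∈ g_α \ {0} with B(e_α, e_{−α}) = 1 for all α ∈ Φ such that σ(e_α) = e_{μ(α)} for all α ∈ Φ, where μ: Φ → Φ is the ℤ-linear extension of μ; moreover σ(h_α) = h_{μ(α)} for all α ∈ Φ. -/
open TensorProduct

set_option linter.unusedVariables false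

/-- The root space of `α` relative to the subalgebra `H`:
all `x ∈ L` with `⁅y, x⁆ = α y • x` for every `y ∈ H`. -/
def rootSpace' {L : Type*} [LieRing L] [LieAlgebra ℂ L]
    (H : LieSubalgebra ℂ L) (α : Module.Dual ℂ H) : Submodule ℂ L where
  carrier := {x | ∀ y : H, ⁅(y : L), x⁆ = α y • x}
  add_mem' := by
    intro a b ha hb y
    rw [lie_add, ha y, hb y, smul_add]
  zero_mem' := by
    intro y
    rw [lie_zero, smul_zero]
  smul_mem' := by
    intro c x hx y
    rw [lie_smul, hx y, smul_comm]

open LieAlgebra LieAlgebra.IsKilling LieModule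

/-- Traces of endomorphisms intertwined by a conjugate-linear involution are complex conjugate. -/
lemma LinearMap.trace_eq_conj_trace_of_comp_eq
    {V : Type*} [AddCommGroup V] [Module ℂ V] [FiniteDimensional ℂ V]
    (σ : V → V) (hadd : ∀ x y, σ (x + y) = σ x + σ y)
    (hsmul : ∀ (z : ℂ) (x : V), σ (z • x) = (starRingEnd ℂ) z • σ x)
    (hinv : ∀ x, σ (σ x) = x) (f g : V →ₗ[ℂ] V) (hfg : ∀ x, g (σ x) = σ (f x)) :
    LinearMap.trace ℂ V g = (starRingEnd ℂ) (LinearMap.trace ℂ V f) := by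
  classical
  let b := Module.finBasis ℂ V
  let b' : Module.Basis (Fin (Module.finrank ℂ V)) ℂ V := Module.Basis.ofEquivFun
    { toFun := fun x i => (starRingEnd ℂ) (b.equivFun (σ x) i)
      map_add' := fun x y => by ext i; simp [hadd]
      map_smul' := fun c x => by ext i; simp [hsmul]
      invFun := fun v => σ (b.equivFun.symm fun i => (starRingEnd ℂ) (v i))
      left_inv := fun x => by simp [hinv]
      right_inv := fun v => by
        ext i
        dsimp only
        rw [hinv, LinearEquiv.apply_symm_apply, Complex.conj_conj] }
  have hb' (i) : b' i = σ (b i) := by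
    simp only [b', Module.Basis.coe_ofEquivFun]
    change σ (b.equivFun.symm _) = _
    congr 1
    rw [LinearEquiv.symm_apply_eq]
    ext j
    by_cases h : i = j
    · subst h; simp
    · simp [h, Ne.symm h]
  have hrepr (x : V) (i) : b'.repr x i = (starRingEnd ℂ) (b.repr (σ x) i) := by
    rw [← Module.Basis.equivFun_apply]
    simp [b']
  rw [LinearMap.trace_eq_matrix_trace ℂ b' g, LinearMap.trace_eq_matrix_trace ℂ b f]
  simp [Matrix.trace, LinearMap.toMatrix_apply, hb', hrepr, hfg, hinv]

/-- A conjugate-linear involution of a Lie algebra conjugates its Killing form. -/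
lemma killingForm_conjLinear_apply_apply
    {L : Type*} [LieRing L] [LieAlgebra ℂ L] [FiniteDimensional ℂ L]
    (σ : L → L) (hadd : ∀ x y, σ (x + y) = σ x + σ y)
    (hsmul : ∀ (z : ℂ) (x : L), σ (z • x) = (starRingEnd ℂ) z • σ x)
    (hinv : ∀ x, σ (σ x) = x) (hlie : ∀ x y : L, σ ⁅x, y⁆ = ⁅σ x, σ y⁆) (x y : L) :
    killingForm ℂ L (σ x) (σ y) = (starRingEnd ℂ) (killingForm ℂ L x y) := by
  rw [killingForm_apply_apply, killingForm_apply_apply]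
  exact LinearMap.trace_eq_conj_trace_of_comp_eq σ hadd hsmul hinv _ _ fun z => by simp [hlie]

section RootSpaces

variable {L : Type*} [LieRing L] [LieAlgebra ℂ L] [FiniteDimensional ℂ L] [IsKilling ℂ L]
  (H : LieSubalgebra ℂ L) [H.IsCartanSubalgebra]

lemma mem_rootSpace'_iff (α : Module.Dual ℂ H) (x : L) :
    x ∈ rootSpace' H α ↔ x ∈ rootSpace H α := by
  refine ⟨fun h => (mem_genWeightSpace L α x).mpr fun y => ⟨1, ?_⟩,
    fun h y => lie_eq_smul_of_mem_rootSpace h y⟩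
  have := h y
  simp [← this]

lemma exists_isNonZero_weight_toLinear_eq {α : Module.Dual ℂ H} (hα : α ≠ 0)
    (h : rootSpace' H α ≠ ⊥) :
    ∃ χ : Weight ℂ H L, χ.IsNonZero ∧ χ.toLinear = α := by
  obtain ⟨x, hx, hx0⟩ := (Submodule.ne_bot_iff _).mp h
  have hne : genWeightSpace L (α : H → ℂ) ≠ ⊥ := fun e => hx0 <| by
    simpa [e] using (mem_rootSpace'_iff H α x).mp hx
  refine ⟨⟨α, hne⟩, fun e => hα ?_, ?_⟩
  · ext y; exact congrFun e y
  · ext y; rfl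

lemma exists_smul_eq_of_mem_rootSpace' {α : Module.Dual ℂ H} (hα : α ≠ 0) {x y : L}
    (hx : x ∈ rootSpace' H α) (hx0 : x ≠ 0) (hy : y ∈ rootSpace' H α) :
    ∃ c : ℂ, c • x = y := by
  obtain ⟨χ, hχ, rfl⟩ := exists_isNonZero_weight_toLinear_eq H hα
    ((Submodule.ne_bot_iff _).mpr ⟨x, hx, hx0⟩)
  rw [mem_rootSpace'_iff] at hx hy
  obtain ⟨c, hc⟩ := (finrank_eq_one_iff_of_nonzero' (⟨x, hx⟩ : rootSpace H χ.toLinear)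
    (fun h => hx0 (congrArg Subtype.val h))).mp (finrank_rootSpace_eq_one χ hχ) ⟨y, hy⟩
  exact ⟨c, congrArg Subtype.val hc⟩

lemma killingForm_ne_zero_of_mem_rootSpace' {α : Module.Dual ℂ H} (hα : α ≠ 0) {x y : L}
    (hx : x ∈ rootSpace' H α) (hx0 : x ≠ 0) (hy : y ∈ rootSpace' H (-α)) (hy0 : y ≠ 0) :
    killingForm ℂ L x y ≠ 0 := by
  intro h0
  refine hx0 ?_
  have := mem_ker_killingForm_of_mem_rootSpace_of_forall_rootSpace_neg ℂ L H
    ((mem_rootSpace'_iff H α x).mp hx) fun z hz => by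
      obtain ⟨c, rfl⟩ := exists_smul_eq_of_mem_rootSpace' H (neg_ne_zero.mpr hα) hy hy0
        ((mem_rootSpace'_iff H (-α) z).mpr hz)
      simp [h0]
  simpa using this

lemma conj_killingForm_coroot (χ : Weight ℂ H L) :
    (starRingEnd ℂ) (killingForm ℂ L (coroot χ : H) (coroot χ : H)) =
      killingForm ℂ L (coroot χ : H) (coroot χ : H) := by
  have h : killingForm ℂ L (coroot χ : H) (coroot χ : H) =
      ∑ α ∈ H.root, α (coroot χ) * α (coroot χ) := by
    change (killingForm ℂ L).restrict H (coroot χ) (coroot χ) = _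
    rw [restrict_killingForm_eq_sum]
    simp only [LinearMap.sum_apply, LinearMap.smulRight_apply, LinearMap.smul_apply, smul_eq_mul]
    rfl
  rw [h]
  simp [apply_coroot_eq_cast]

/-- The Killing form takes real values on pairs of vectors dual to roots. -/
lemma conj_root_apply_dual_vector (χ ψ : Weight ℂ H L) (hχ : χ.IsNonZero) (v : H)
    (hv : ∀ x : H, killingForm ℂ L (v : L) (x : L) = χ x) :
    (starRingEnd ℂ) (ψ v) = ψ v := by
  have hvdual : (cartanEquivDual H).symm χ.toLinear = v := by
    rw [LinearEquiv.symm_apply_eq]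
    ext x
    exact (hv x).symm
  have hne : χ v ≠ 0 := hvdual ▸ root_apply_cartanEquivDual_symm_ne_zero hχ
  have hco : coroot χ = (2 * (χ v)⁻¹) • v := by
    rw [coroot, hvdual, mul_smul, two_smul, two_smul]
  have hc : (starRingEnd ℂ) (χ v) = χ v := by
    have h := conj_killingForm_coroot H χ
    have hv' := hv v
    simp only [hco, SetLike.val_smul, map_smul, LinearMap.smul_apply, hv',
      smul_eq_mul, map_mul, map_inv₀, map_ofNat] at h
    have hne' : (starRingEnd ℂ) (χ v) ≠ 0 := by simpa using hne
    field_simp at h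
    exact h.symm
  have hψ : ψ (coroot χ) = (2 * (χ v)⁻¹) * ψ v := by
    rw [hco, ← Weight.toLinear_apply, map_smul, smul_eq_mul, Weight.toLinear_apply]
  have h2 : ψ v = (χ v / 2) * ψ (coroot χ) := by
    rw [hψ]; field_simp
  rw [h2, apply_coroot_eq_cast]
  simp [hc, Complex.conj_ofNat]

end RootSpaces

/-- A family of one-dimensional complex vector spaces permuted by a conjugate-linear involution
admits an equivariant family of nonzero vectors. -/
lemma exists_equivariant_family_of_conjLinear_involution
    {V ι : Type*} [AddCommGroup V] [Module ℂ V] (σ : V → V)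
    (hadd : ∀ x y, σ (x + y) = σ x + σ y)
    (hsmul : ∀ (z : ℂ) (x : V), σ (z • x) = (starRingEnd ℂ) z • σ x)
    (hinv : ∀ x, σ (σ x) = x) (τ : ι → ι) (hτ : ∀ i, τ (τ i) = i)
    (S : Set ι) (hS : ∀ i ∈ S, τ i ∈ S) (W : ι → Submodule ℂ V)
    (hW : ∀ i, ∀ x ∈ W i, σ x ∈ W (τ i)) (hW0 : ∀ i ∈ S, W i ≠ ⊥)
    (hW1 : ∀ i ∈ S, ∀ x ∈ W i, x ≠ 0 → ∀ y ∈ W i, ∃ c : ℂ, c • x = y) :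
    ∃ f : ι → V, (∀ i ∈ S, f i ∈ W i ∧ f i ≠ 0) ∧ ∀ i ∈ S, σ (f i) = f (τ i) := by
  classical
  have h0 : σ 0 = 0 := by simpa using hsmul 0 0
  have hne (x : V) (hx : x ≠ 0) : σ x ≠ 0 := fun h => hx (by rw [← hinv x, h, h0])
  have hfix (i) (hi : i ∈ S) : ∃ x ∈ W i, x ≠ 0 ∧ (τ i = i → σ x = x) := by
    obtain ⟨x, hx, hx0⟩ := (Submodule.ne_bot_iff _).mp (hW0 i hi)
    by_cases hti : τ i = i
    · by_cases hs : σ x = -x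
      · refine ⟨Complex.I • x, (W i).smul_mem _ hx, smul_ne_zero Complex.I_ne_zero hx0, ?_⟩
        simp [hsmul, hs]
      · refine ⟨x + σ x, (W i).add_mem hx (by simpa [hti] using hW i x hx), fun h => hs ?_,
          fun _ => by rw [hadd, hinv, add_comm]⟩
        exact (neg_eq_of_add_eq_zero_right h).symm
    · exact ⟨x, hx, hx0, fun h => absurd h hti⟩
  choose! v hv hv0 hvfix using hfix
  let rep (i : ι) : ι := (s(i, τ i) : Sym2 ι).out.1
  have hrep (i) : rep i = i ∨ rep i = τ i := by
    simpa using Sym2.out_fst_mem s(i, τ i)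
  have hrepτ (i) : rep (τ i) = rep i := by
    simp only [rep, hτ]
    rw [Sym2.eq_swap]
  refine ⟨fun i => if rep i = i then v i else σ (v (τ i)), fun i hi => ?_, fun i hi => ?_⟩
  · dsimp only
    split_ifs
    · exact ⟨hv i hi, hv0 i hi⟩
    · exact ⟨by simpa [hτ] using hW _ _ (hv _ (hS i hi)), hne _ (hv0 _ (hS i hi))⟩
  · dsimp only
    rw [hrepτ, hτ]
    by_cases h1 : rep i = i
    · by_cases h2 : rep i = τ i
      · have : τ i = i := h2.symm.trans h1
        rw [if_pos h1, if_pos h2, this, hvfix i hi this]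
      · rw [if_pos h1, if_neg h2]
    · rw [if_neg h1, if_pos ((hrep i).resolve_left h1), hinv]

/-- A nonzero vector is not both a nonnegative and a nonpositive combination of a linearly
independent family. -/
lemma not_nonneg_and_neg_nonneg_of_linearIndependent
    {V : Type*} [AddCommGroup V] [Module ℂ V] (Δ : Finset V)
    (hind : LinearIndependent ℂ (fun b : {x // x ∈ Δ} => (b : V))) {v : V} (hv : v ≠ 0)
    {k l : V → ℤ} (hk : ∀ b ∈ Δ, 0 ≤ k b) (hl : ∀ b ∈ Δ, 0 ≤ l b)
    (hvk : v = ∑ b ∈ Δ, k b • b) (hvl : -v = ∑ b ∈ Δ, l b • b) : False := by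
  have hsum : ∑ b ∈ Δ, ((k b + l b : ℤ) : ℂ) • b = 0 := by
    simp only [Int.cast_smul_eq_zsmul, add_smul, Finset.sum_add_distrib]
    rw [← hvk, ← hvl, add_neg_cancel]
  rw [← Finset.sum_coe_sort] at hsum
  have h0 := Fintype.linearIndependent_iff.mp hind (fun b => ((k b + l b : ℤ) : ℂ)) hsum
  refine hv ?_
  rw [hvk]
  refine Finset.sum_eq_zero fun b hb => ?_
  have h1 : k b + l b = 0 := by exact_mod_cast h0 ⟨b, hb⟩
  have : k b = 0 := by linarith [hk b hb, hl b hb]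
  rw [this, zero_smul]

theorem statement1
    {L : Type*} [LieRing L] [LieAlgebra ℂ L] [FiniteDimensional ℂ L]
    [LieAlgebra.IsSimple ℂ L]
    -- `H` is a Cartan subalgebra of the simple complex Lie algebra `L`
    (H : LieSubalgebra ℂ L) [LieSubalgebra.IsCartanSubalgebra H]
    -- `Φ` is the set of roots of `L` relative to `H`
    (Φ : Set (Module.Dual ℂ H))
    (hΦ : ∀ α : Module.Dual ℂ H, α ∈ Φ ↔ α ≠ 0 ∧ rootSpace' H α ≠ ⊥)
    (hΦneg : ∀ γ ∈ Φ, -γ ∈ Φ)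
    -- `hvec lam` is the element `h_lam ∈ H` representing `lam` via the Killing form
    (hvec : Module.Dual ℂ H → H)
    (hhvec : ∀ (lam : Module.Dual ℂ H) (x : H),
      killingForm ℂ L (hvec lam : L) (x : L) = lam x)
    -- `Δ` is a system of simple roots for `Φ`
    (Δ : Finset (Module.Dual ℂ H)) (hΔΦ : ↑Δ ⊆ Φ)
    (hind : LinearIndependent ℂ (fun b : {x // x ∈ Δ} => (b : Module.Dual ℂ H)))
    (hbase : ∀ γ ∈ Φ, ∃ k : Module.Dual ℂ H → ℤ,
      ((∀ b ∈ Δ, 0 ≤ k b) ∨ (∀ b ∈ Δ, k b ≤ 0)) ∧ γ = ∑ b ∈ Δ, k b • b)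
    -- `σ` is a conjugate-linear Lie algebra involution of `L`
    (σ : L → L)
    (hσadd : ∀ x y, σ (x + y) = σ x + σ y)
    (hσsmul : ∀ (z : ℂ) (x : L), σ (z • x) = (starRingEnd ℂ) z • σ x)
    (hσσ : ∀ x, σ (σ x) = x)
    (hσlie : ∀ x y : L, σ ⁅x, y⁆ = ⁅σ x, σ y⁆)
    (hσH : ∀ x : H, σ (x : L) ∈ H)
    -- `σstar` is the adjoint of `σ` on the dual of `H`: `σstar lam x = conj (lam (σ x))`
    (σstar : Module.Dual ℂ H → Module.Dual ℂ H)
    (hσstar : ∀ (lam : Module.Dual ℂ H) (x : H),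
      σstar lam x = (starRingEnd ℂ) (lam ⟨σ (x : L), hσH x⟩))
    -- hypothesis: `σ*(Δ) = Δ`
    (hstarΔ : σstar '' ↑Δ = ↑Δ) :
    -- `μ := σ*|_Δ` is a diagram automorphism of order 1 or 2 ...
    Set.BijOn σstar ↑Δ ↑Δ ∧
    (∀ b ∈ Δ, σstar (σstar b) = b) ∧
    (∀ a ∈ Δ, ∀ b ∈ Δ,
      killingForm ℂ L (hvec (σstar a) : L) (hvec (σstar b) : L)
        = killingForm ℂ L (hvec a : L) (hvec b : L)) ∧
    -- ... `σ (h_α) = h_{μ α}` for all roots `α` (here `σstar` restricted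
    -- to `Φ` is the ℤ-linear extension of `μ`, since `σstar` is additive) ...
    (∀ α ∈ Φ, σ (hvec α : L) = (hvec (σstar α) : L)) ∧
    -- ... and there is a choice of root vectors with `σ (e α) = e (μ α)` for all `α ∈ Φ`.
    ∃ e : Module.Dual ℂ H → L,
      (∀ α ∈ Φ, e α ∈ rootSpace' H α ∧ e α ≠ 0) ∧
      (∀ α ∈ Φ, killingForm ℂ L (e α) (e (-α)) = 1) ∧
      (∀ α ∈ Φ, σ (e α) = e (σstar α)) := by
  have hΦ0 (α) (h : α ∈ Φ) : α ≠ 0 := ((hΦ α).mp h).1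
  have hσ0 : σ 0 = 0 := by simpa using hσsmul 0 0
  have hσne (x : L) (hx : x ≠ 0) : σ x ≠ 0 := fun h => hx (by rw [← hσσ x, h, hσ0])
  have hBσ := killingForm_conjLinear_apply_apply σ hσadd hσsmul hσσ hσlie
  have hinv (α) : σstar (σstar α) = α := by
    ext x
    simp [hσstar, hσσ]
  have hstar_add (α β) : σstar (α + β) = σstar α + σstar β := by
    ext x
    simp [hσstar]
  let σadd : Module.Dual ℂ H →+ Module.Dual ℂ H := AddMonoidHom.mk' σstar hstar_add
  have hstar_neg (α) : σstar (-α) = -σstar α := map_neg σadd α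
  have hmaps (b) (hb : b ∈ Δ) : σstar b ∈ Δ := by
    have : σstar b ∈ σstar '' (Δ : Set (Module.Dual ℂ H)) := ⟨b, hb, rfl⟩
    rwa [hstarΔ] at this
  have hrs (α) (x) (hx : x ∈ rootSpace' H α) : σ x ∈ rootSpace' H (σstar α) := by
    intro y
    have h := congrArg σ (hx ⟨σ y, hσH y⟩)
    rw [hσlie, hσσ, hσsmul] at h
    rw [h, hσstar]
  have hstarΦ (α) (hα : α ∈ Φ) : σstar α ∈ Φ := by
    obtain ⟨h0, hb⟩ := (hΦ α).mp hα
    refine (hΦ _).mpr ⟨fun h => h0 ?_, ?_⟩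
    · rw [← hinv α, h]
      exact map_zero σadd
    · obtain ⟨x, hx, hx0⟩ := (Submodule.ne_bot_iff _).mp hb
      exact (Submodule.ne_bot_iff _).mpr ⟨σ x, hrs α x hx, hσne x hx0⟩
  have hσhvec (α) : σ (hvec α : L) = (hvec (σstar α) : L) := by
    have h : (⟨σ (hvec α : L), hσH _⟩ : H) = hvec (σstar α) := by
      apply (cartanEquivDual H).injective
      ext x
      change killingForm ℂ L (σ (hvec α)) x = killingForm ℂ L (hvec (σstar α)) x
      rw [hhvec, hσstar, ← hhvec, ← hBσ, hσσ]
    exact congrArg Subtype.val h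
  refine ⟨⟨hmaps, fun a _ b _ h => ?_, hstarΔ.ge⟩, fun b _ => hinv b, fun a ha b hb => ?_,
    fun α _ => hσhvec α, ?_⟩
  · rw [← hinv a, h, hinv]
  · obtain ⟨χ, hχ, rfl⟩ := exists_isNonZero_weight_toLinear_eq H (hΦ0 a (hΔΦ ha))
      ((hΦ a).mp (hΔΦ ha)).2
    obtain ⟨ψ, hψ, rfl⟩ := exists_isNonZero_weight_toLinear_eq H (hΦ0 b (hΔΦ hb))
      ((hΦ b).mp (hΔΦ hb)).2
    rw [← hσhvec, ← hσhvec, hBσ, hhvec]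
    exact conj_root_apply_dual_vector H ψ χ hψ _ (hhvec ψ.toLinear)
  · obtain ⟨f, hf, hfσ⟩ := exists_equivariant_family_of_conjLinear_involution σ hσadd hσsmul hσσ
      σstar hinv Φ hstarΦ (rootSpace' H) hrs (fun α hα => ((hΦ α).mp hα).2)
      (fun α hα x hx hx0 y hy => exists_smul_eq_of_mem_rootSpace' H (hΦ0 α hα) hx hx0 hy)
    classical
    let pos (α : Module.Dual ℂ H) : Prop :=
      ∃ k : Module.Dual ℂ H → ℤ, (∀ b ∈ Δ, 0 ≤ k b) ∧ α = ∑ b ∈ Δ, k b • b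
    have hpos_star (α) (h : pos α) : pos (σstar α) := by
      obtain ⟨k, hk, rfl⟩ := h
      refine ⟨fun b => k (σstar b), fun b hb => hk _ (hmaps b hb), ?_⟩
      have : σstar (∑ b ∈ Δ, k b • b) = ∑ b ∈ Δ, k b • σstar b := by
        change σadd _ = _
        rw [map_sum]
        exact Finset.sum_congr rfl fun b _ => map_zsmul σadd _ _
      rw [this]
      exact Finset.sum_bij' (fun b _ => σstar b) (fun b _ => σstar b) hmaps hmaps
        (fun b _ => hinv b) (fun b _ => hinv b) fun b _ => by dsimp only; rw [hinv]
    have hpos_star_iff (α) : pos (σstar α) ↔ pos α :=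
      ⟨fun h => by simpa [hinv] using hpos_star _ h, hpos_star α⟩
    have hpos_neg (α) (hα : α ∈ Φ) : pos (-α) ↔ ¬ pos α := by
      constructor
      · rintro ⟨l, hl, hvl⟩ ⟨k, hk, hvk⟩
        exact not_nonneg_and_neg_nonneg_of_linearIndependent Δ hind (hΦ0 α hα) hk hl hvk hvl
      · intro h
        obtain ⟨k, hk | hk, hvk⟩ := hbase α hα
        · exact absurd ⟨k, hk, hvk⟩ h
        · refine ⟨fun b => -k b, fun b hb => by simpa using hk b hb, ?_⟩
          rw [hvk]
          simp
    have hB0 (α) (hα : α ∈ Φ) : killingForm ℂ L (f α) (f (-α)) ≠ 0 :=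
      killingForm_ne_zero_of_mem_rootSpace' H (hΦ0 α hα) (hf α hα).1 (hf α hα).2
        (hf _ (hΦneg α hα)).1 (hf _ (hΦneg α hα)).2
    refine ⟨fun α => if pos α then f α else (killingForm ℂ L (f α) (f (-α)))⁻¹ • f α,
      fun α hα => ?_, fun α hα => ?_, fun α hα => ?_⟩
    · dsimp only
      split_ifs
      · exact hf α hα
      · exact ⟨Submodule.smul_mem _ _ (hf α hα).1,
          smul_ne_zero (inv_ne_zero (hB0 α hα)) (hf α hα).2⟩
    · have hsymm : killingForm ℂ L (f (-α)) (f α) = killingForm ℂ L (f α) (f (-α)) :=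
        LieModule.traceForm_comm ℂ L L _ _
      by_cases h : pos α
      · have h' : ¬ pos (-α) := fun h' => (hpos_neg α hα).mp h' h
        simp [h, h', hsymm, hB0 α hα]
      · have h' : pos (-α) := (hpos_neg α hα).mpr h
        simp [h, h', hB0 α hα]
    · dsimp only
      rw [apply_ite σ]
      simp only [hpos_star_iff, hσsmul, map_inv₀, ← hBσ]
      rw [hfσ α hα, hfσ _ (hΦneg α hα), hstar_neg]
end

section
/- Let a be a finite-dimensional complex Lie algebra with a nondegenerate symmetric invariant ℂ-bilinear form ⟨ , ⟩. Let σ be a conjugate-linear Lie algebra involution of a satisfying ⟨σ(u), σ(v)⟩ = conj(⟨u, v⟩) for all u, v ∈ a, and let θ be a ℂ-linear Lie algebra involution of a commuting with σ and preserving ⟨ , ⟩ (i.e. ⟨θ(u), θ(v)⟩ = ⟨u, v⟩). Set m = {x ∈ a : σ(θ(x)) = x}. Then m is a real Lie subalgebra of a (viewed as a real Lie algebra), m is isotropic for the real-valued bilinear form (u | v) = ⟨u, v⟩ − ⟨σ(u), σ(v)⟩ = 2·Re⟨u, v⟩, and dim_ℝ m = dim_ℂ a; that is, m is a Lagrangian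 subalgebra of the realification of a. -/
/-- The real form of a complex vector space given by the fixed points of a conjugate-linear map. -/
def realFixedPoints {V : Type*} [AddCommGroup V] [Module ℂ V]
    (τ : V →ₛₗ[starRingEnd ℂ] V) : Submodule ℝ V where
  carrier := {x | τ x = x}
  add_mem' {x y} hx hy := by
    simp only [Set.mem_ofPred_eq] at hx hy ⊢
    rw [map_add, hx, hy]
  zero_mem' := map_zero τ
  smul_mem' r x hx := by
    simp only [Set.mem_ofPred_eq] at hx ⊢
    rw [← Complex.coe_smul, map_smulₛₗ, hx, Complex.conj_ofReal]

theorem mem_realFixedPoints {V : Type*} [AddCommGroup V] [Module ℂ V]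
    {τ : V →ₛₗ[starRingEnd ℂ] V} {x : V} : x ∈ realFixedPoints τ ↔ τ x = x :=
  Iff.rfl

/-- A complex vector space with a conjugate-linear involution is the direct sum of the real form
of fixed points and its multiple by `I`. -/
noncomputable def realFixedPointsProdEquiv {V : Type*} [AddCommGroup V] [Module ℂ V]
    (τ : V →ₛₗ[starRingEnd ℂ] V) (hτ : ∀ x, τ (τ x) = x) :
    (realFixedPoints τ × realFixedPoints τ) ≃ₗ[ℝ] V where
  toFun p := (p.1 : V) + Complex.I • (p.2 : V)
  map_add' p q := by
    simp only [Prod.fst_add, Prod.snd_add, Submodule.coe_add, smul_add]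
    abel
  map_smul' r p := by
    simp only [Prod.smul_fst, Prod.smul_snd, Submodule.coe_smul, smul_add, RingHom.id_apply,
      smul_comm Complex.I r]
  invFun x :=
    (⟨(1 / 2 : ℂ) • (x + τ x), by
        simp [mem_realFixedPoints, map_smulₛₗ, hτ, add_comm, Complex.conj_ofNat]⟩,
      ⟨(-Complex.I / 2) • (x - τ x), by
        rw [mem_realFixedPoints, map_smulₛₗ, map_sub, hτ, ← neg_sub x, smul_neg, ← neg_smul]
        simp [neg_div, Complex.conj_ofNat]⟩)
  left_inv := by
    rintro ⟨⟨u, hu⟩, ⟨v, hv⟩⟩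
    rw [mem_realFixedPoints] at hu hv
    ext
    · simp only [map_add, map_smulₛₗ, hu, hv, Complex.conj_I]
      module
    · simp only [map_add, map_smulₛₗ, hu, hv, Complex.conj_I]
      match_scalars <;> ring_nf <;> simp
  right_inv x := by
    match_scalars <;> ring_nf <;> norm_num

theorem finrank_realFixedPoints {V : Type*} [AddCommGroup V] [Module ℂ V]
    [FiniteDimensional ℂ V] (τ : V →ₛₗ[starRingEnd ℂ] V) (hτ : ∀ x, τ (τ x) = x) :
    Module.finrank ℝ (realFixedPoints τ) = Module.finrank ℂ V := by
  have : FiniteDimensional ℝ V := FiniteDimensional.complexToReal V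
  have h := (realFixedPointsProdEquiv τ hτ).finrank_eq
  rw [Module.finrank_prod, finrank_real_of_complex] at h
  omega


theorem statement6 {A : Type*} [LieRing A] [LieAlgebra ℂ A] [FiniteDimensional ℂ A]
    -- a nondegenerate symmetric invariant ℂ-bilinear form on `A`
    (f : A →ₗ[ℂ] A →ₗ[ℂ] ℂ)
    (hsymm : ∀ x y, f x y = f y x)
    (hinvt : ∀ x y z, f ⁅x, y⁆ z = f x ⁅y, z⁆)
    (hnd : ∀ x, (∀ y, f x y = 0) → x = 0)
    -- `σ` is a conjugate-linear Lie algebra involution of `A`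
    (σ : A → A)
    (hσadd : ∀ x y, σ (x + y) = σ x + σ y)
    (hσsmul : ∀ (z : ℂ) (x : A), σ (z • x) = (starRingEnd ℂ) z • σ x)
    (hσσ : ∀ x, σ (σ x) = x)
    (hσlie : ∀ x y : A, σ ⁅x, y⁆ = ⁅σ x, σ y⁆)
    (hσf : ∀ u v, f (σ u) (σ v) = (starRingEnd ℂ) (f u v))
    -- `θ` is a ℂ-linear Lie algebra involution of `A` commuting with `σ`
    -- and preserving the form
    (θ : A →ₗ[ℂ] A)
    (hθlie : ∀ x y : A, θ ⁅x, y⁆ = ⁅θ x, θ y⁆)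
    (hθθ : ∀ x, θ (θ x) = x)
    (hcomm : ∀ x, σ (θ x) = θ (σ x))
    (hθf : ∀ u v, f (θ u) (θ v) = f u v) :
    -- `m = {x : σ(θ x) = x}` is a real Lie subalgebra, isotropic for the form
    -- `(u | v) = f u v - f (σ u) (σ v)`, of real dimension `dim_ℂ A`:
    -- a Lagrangian subalgebra of the realification of `A`.
    ∃ m : Submodule ℝ A,
      (m : Set A) = {x : A | σ (θ x) = x} ∧
      (∀ x ∈ m, ∀ y ∈ m, ⁅x, y⁆ ∈ m) ∧
      (∀ u ∈ m, ∀ v ∈ m, f u v - f (σ u) (σ v) = 0) ∧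
      Module.finrank ℝ m = Module.finrank ℂ A := by
  let τ : A →ₛₗ[starRingEnd ℂ] A :=
    { toFun := fun x => σ (θ x)
      map_add' := fun x y => by rw [map_add, hσadd]
      map_smul' := fun c x => by rw [map_smul, hσsmul] }
  refine ⟨realFixedPoints τ, rfl, fun x hx y hy => ?_, fun u hu v hv => ?_,
    finrank_realFixedPoints τ fun x => ?_⟩
  · change σ (θ x) = x at hx
    change σ (θ y) = y at hy
    change σ (θ ⁅x, y⁆) = ⁅x, y⁆
    rw [hθlie, hσlie, hx, hy]
  · change σ (θ u) = u at hu
    change σ (θ v) = v at hv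
    have h : f u v = (starRingEnd ℂ) (f u v) := by
      conv_lhs => rw [← hu, ← hv, hσf, hθf]
    rw [hσf, ← h, sub_self]
  · change σ (θ (σ (θ x))) = x
    rw [← hcomm, hσσ, hθθ]
end

section
/- Let g be a finite-dimensional real Lie algebra, θ an involutive Lie algebra automorphism of g, k = {x ∈ g : θ(x) = x} and p = {x ∈ g : θ(x) = −x} (so g = k ⊕ p). Let r ∈ g ⊗ g and for u ∈ g define δ(u) = u·r, where · denotes the adjoint action of g on g ⊗ g (u·(x⊗y) = [u,x]⊗y + x⊗[u,y]). Then δ(u) ∈ k ⊗ g + g ⊗ k for all u ∈ k if and only if u·(((id − θ) ⊗ (id − θ))(r)) = 0 for all u ∈ k. -/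
open TensorProduct

/-- For a linear involution `f`, the kernel of `(id - f) ⊗ (id - f)` is the span of the pure tensors
with at least one factor fixed by `f`. -/
theorem LinearMap.ker_map_id_sub_of_involutive {K M : Type*} [Field K] [NeZero (2 : K)]
    [AddCommGroup M] [Module K M] (f : M →ₗ[K] M) (hf : ∀ x, f (f x) = x) :
    LinearMap.ker (TensorProduct.map (LinearMap.id - f) (LinearMap.id - f)) =
      Submodule.span K
        ({z : M ⊗[K] M | ∃ x y : M, f x = x ∧ z = x ⊗ₜ[K] y} ∪
         {z : M ⊗[K] M | ∃ x y : M, f y = y ∧ z = x ⊗ₜ[K] y}) := by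
  have h2 : (2 : K) ≠ 0 := NeZero.ne 2
  set S := Submodule.span K
        ({z : M ⊗[K] M | ∃ x y : M, f x = x ∧ z = x ⊗ₜ[K] y} ∪
         {z : M ⊗[K] M | ∃ x y : M, f y = y ∧ z = x ⊗ₜ[K] y}) with hS
  apply le_antisymm
  · have key (z : M ⊗[K] M) : (2 : K) • (2 : K) • z -
        TensorProduct.map (LinearMap.id - f) (LinearMap.id - f) z ∈ S := by
      induction z using TensorProduct.induction_on with
      | zero => simp
      | tmul x y =>
        have hx : (x + f x) ⊗ₜ[K] ((2 : K) • y) ∈ S :=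
          Submodule.subset_span (Or.inl ⟨_, _, by rw [map_add, hf, add_comm], rfl⟩)
        have hy : (x - f x) ⊗ₜ[K] (y + f y) ∈ S :=
          Submodule.subset_span (Or.inr ⟨_, _, by rw [map_add, hf, add_comm], rfl⟩)
        convert S.add_mem hx hy using 1
        simp only [TensorProduct.map_tmul, LinearMap.sub_apply, LinearMap.id_apply,
          TensorProduct.add_tmul, TensorProduct.sub_tmul, TensorProduct.tmul_add,
          TensorProduct.tmul_sub, TensorProduct.tmul_smul]
        module
      | add a b ha hb =>
        convert S.add_mem ha hb using 1
        rw [map_add]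
        module
    intro z hz
    have h := key z
    rw [LinearMap.mem_ker.mp hz, sub_zero] at h
    exact (S.smul_mem_iff h2).mp ((S.smul_mem_iff h2).mp h)
  · rw [hS, Submodule.span_le]
    rintro _ (⟨x, y, h, rfl⟩ | ⟨x, y, h, rfl⟩) <;> simp [h]

/-- If `u` is fixed by `θ`, the action of `u` commutes with `(id - θ) ⊗ (id - θ)`. -/
theorem LieHom.map_id_sub_lie {R L : Type*} [CommRing R] [LieRing L] [LieAlgebra R L]
    (θ : L →ₗ⁅R⁆ L) {u : L} (hu : θ u = u) (z : L ⊗[R] L) :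
    TensorProduct.map (LinearMap.id - θ.toLinearMap) (LinearMap.id - θ.toLinearMap) ⁅u, z⁆ =
      ⁅u, TensorProduct.map (LinearMap.id - θ.toLinearMap) (LinearMap.id - θ.toLinearMap) z⁆ := by
  induction z using TensorProduct.induction_on with
  | zero => simp
  | tmul x y => simp [TensorProduct.LieModule.lie_tmul_right, hu, lie_sub]
  | add a b ha hb => rw [lie_add, map_add, ha, hb, map_add, lie_add]

theorem statement7 {G : Type*} [LieRing G] [LieAlgebra ℝ G] [FiniteDimensional ℝ G]
    -- `θ` is an involutive Lie algebra automorphism of `G`,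
    -- `k = {x : θ x = x}` its fixed subalgebra
    (θ : G →ₗ⁅ℝ⁆ G)
    (hθθ : ∀ x, θ (θ x) = x)
    (r : G ⊗[ℝ] G) :
    -- `δ u = ⁅u, r⁆ ∈ k ⊗ g + g ⊗ k` for all `u ∈ k` iff
    -- `⁅u, ((id - θ) ⊗ (id - θ)) r⁆ = 0` for all `u ∈ k`
    ((∀ u : G, θ u = u →
        ⁅u, r⁆ ∈ Submodule.span ℝ
          ({z : G ⊗[ℝ] G | ∃ x y : G, θ x = x ∧ z = x ⊗ₜ[ℝ] y} ∪
           {z : G ⊗[ℝ] G | ∃ x y : G, θ y = y ∧ z = x ⊗ₜ[ℝ] y})) ↔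
      (∀ u : G, θ u = u →
        ⁅u, TensorProduct.map (LinearMap.id - θ.toLinearMap)
              (LinearMap.id - θ.toLinearMap) r⁆ = 0)) := by
  have hker := LinearMap.ker_map_id_sub_of_involutive θ.toLinearMap hθθ
  refine forall₂_congr fun u hu => ?_
  rw [← LieHom.map_id_sub_lie θ hu r, ← LinearMap.mem_ker, hker]
  rfl
end

section
/- Let μ be a diagram automorphism of order 1 or 2 extended ℤ-linearly to Φ, and let θ be a ℂ-linear Lie algebra involution of g satisfying θ(e_γ) = −e_{−μ(γ)} and θ(h_γ) = −h_{μ(γ)} for all γ ∈ Φ. Then the fixed-point subalgebra g^θ equals the ℂ-linear span of {h_α − h_{μ(α)} : α ∈ Φ} ∪ {e_α − e_{−μ(α)} : α ∈ Φ}. -/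
open TensorProduct

set_option linter.unusedVariables false

theorem statement9
    {L : Type*} [LieRing L] [LieAlgebra ℂ L] [FiniteDimensional ℂ L]
    [LieAlgebra.IsSimple ℂ L]
    -- `H` is a Cartan subalgebra of the simple complex Lie algebra `L`
    (H : LieSubalgebra ℂ L) [LieSubalgebra.IsCartanSubalgebra H]
    -- `Φ` is the set of roots of `L` relative to `H`
    (Φ : Set (Module.Dual ℂ H))
    (hΦ : ∀ α : Module.Dual ℂ H, α ∈ Φ ↔ α ≠ 0 ∧ rootSpace' H α ≠ ⊥)
    (hΦneg : ∀ γ ∈ Φ, -γ ∈ Φ)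
    -- `hvec lam` is the element `h_lam ∈ H` representing `lam` via the Killing form
    (hvec : Module.Dual ℂ H → H)
    (hhvec : ∀ (lam : Module.Dual ℂ H) (x : H),
      killingForm ℂ L (hvec lam : L) (x : L) = lam x)
    -- root vectors `e α ∈ g_α \ {0}` normalized by `B (e α) (e (-α)) = 1`
    (e : Module.Dual ℂ H → L)
    (he : ∀ α ∈ Φ, e α ∈ rootSpace' H α)
    (he0 : ∀ α ∈ Φ, e α ≠ 0)
    (heB : ∀ α ∈ Φ, killingForm ℂ L (e α) (e (-α)) = 1)
    (hee : ∀ α ∈ Φ, ⁅e α, e (-α)⁆ = (hvec α : L))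
    -- each root space is spanned by its root vector, and `L = H + ∑ g_α`
    (hspan1 : ∀ α ∈ Φ, rootSpace' H α = Submodule.span ℂ {e α})
    (hdecomp : H.toSubmodule ⊔ Submodule.span ℂ {x : L | ∃ α ∈ Φ, x = e α} = ⊤)
    (hspanH : Submodule.span ℂ {x : L | ∃ α ∈ Φ, x = (hvec α : L)} = H.toSubmodule)
    -- `Δ` is a system of simple roots for `Φ`
    (Δ : Finset (Module.Dual ℂ H)) (hΔΦ : ↑Δ ⊆ Φ)
    (hind : LinearIndependent ℂ (fun b : {x // x ∈ Δ} => (b : Module.Dual ℂ H)))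
    (hbase : ∀ γ ∈ Φ, ∃ k : Module.Dual ℂ H → ℤ,
      ((∀ b ∈ Δ, 0 ≤ k b) ∨ (∀ b ∈ Δ, k b ≤ 0)) ∧ γ = ∑ b ∈ Δ, k b • b)
    -- `μhat` is the ℤ-linear extension of a diagram automorphism `μ : Δ → Δ` of order 1 or 2
    (μhat : Module.Dual ℂ H → Module.Dual ℂ H)
    (hμadd : ∀ x y, μhat (x + y) = μhat x + μhat y)
    (hμneg : ∀ x, μhat (-x) = -(μhat x))
    (hμμ : ∀ x, μhat (μhat x) = x)
    (hμΔ : ∀ b ∈ Δ, μhat b ∈ Δ)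
    (hμΦ : ∀ γ ∈ Φ, μhat γ ∈ Φ)
    (hμB : ∀ a ∈ Δ, ∀ b ∈ Δ,
      killingForm ℂ L (hvec (μhat a) : L) (hvec (μhat b) : L)
        = killingForm ℂ L (hvec a : L) (hvec b : L))
    -- `θ` is a ℂ-linear Lie algebra involution of `L`
    (θ : L →ₗ[ℂ] L)
    (hθlie : ∀ x y : L, θ ⁅x, y⁆ = ⁅θ x, θ y⁆)
    (hθθ : ∀ x, θ (θ x) = x)
    (hθe : ∀ γ ∈ Φ, θ (e γ) = -(e (-(μhat γ))))
    (hθh : ∀ γ ∈ Φ, θ (hvec γ : L) = -(hvec (μhat γ) : L)) :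
    {x : L | θ x = x}
      = ↑(Submodule.span ℂ
          ({y : L | ∃ α ∈ Φ, y = (hvec α : L) - (hvec (μhat α) : L)} ∪
           {y : L | ∃ α ∈ Φ, y = e α - e (-(μhat α))})) := by
  set S := Submodule.span ℂ
    ({y : L | ∃ α ∈ Φ, y = (hvec α : L) - (hvec (μhat α) : L)} ∪
      {y : L | ∃ α ∈ Φ, y = e α - e (-(μhat α))}) with hS
  have hfix : S ≤ LinearMap.eqLocus θ LinearMap.id := by
    rw [hS, Submodule.span_le]
    rintro y (⟨α, hα, rfl⟩ | ⟨α, hα, rfl⟩)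
    · change θ _ = _
      rw [map_sub, hθh α hα, hθh _ (hμΦ α hα), hμμ, LinearMap.id_apply]
      abel
    · change θ _ = _
      rw [map_sub, hθe α hα, hθe _ (hΦneg _ (hμΦ α hα)), hμneg, hμμ, neg_neg,
        LinearMap.id_apply]
      abel
  have hsymm : (⊤ : Submodule ℂ L) ≤ S.comap (LinearMap.id + θ) := by
    rw [← hdecomp, ← hspanH, sup_le_iff, Submodule.span_le, Submodule.span_le]
    constructor
    · rintro _ ⟨α, hα, rfl⟩
      change _ + θ _ ∈ S
      rw [hθh α hα, ← sub_eq_add_neg]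
      exact Submodule.subset_span (Or.inl ⟨α, hα, rfl⟩)
    · rintro _ ⟨α, hα, rfl⟩
      change _ + θ _ ∈ S
      rw [hθe α hα, ← sub_eq_add_neg]
      exact Submodule.subset_span (Or.inr ⟨α, hα, rfl⟩)
  ext x
  refine ⟨fun hx => ?_, fun hx => hfix hx⟩
  have hx2 : x + θ x ∈ S := hsymm (Submodule.mem_top (x := x))
  rw [show θ x = x from hx, ← two_smul ℂ x] at hx2
  exact (S.smul_mem_iff two_ne_zero).mp hx2
end

section
/- Let μ be a diagram automorphism of order 1 or 2 extended ℤ-linearly to Φ, and let θ be the ℂ-linear involution of g with θ(e_γ) = −e_{−μ(γ)} and θ(h_γ) = −h_{μ(γ)} for all γ ∈ Φ. Let t ∈ ℂ and let λ_{α,β} ∈ ℂ (α, β ∈ Δ) be scalars satisfying λ_{α,β} = conj(λ_{μ(α),μ(β)}) for all α, β ∈ Δ, and set r₀ = (t/2)·( Σ_{α,β ∈ Δ} λ_{α,β} h_α ∧ h_β + Σ_{α ∈ Φ⁺} e_{−α} ∧ e_α ) ∈ g ⊗ g. Then ((id − θ) ⊗ (id − θ))(r₀) = (t/2)·Σ_{α,β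 ∈ Δ} t_{α,β} h_α ∧ h_β, where t_{α,β} = 2·Re(λ_{α,β} + λ_{α,μ(β)}). -/
open TensorProduct

set_option linter.unusedVariables false

theorem Finset.sum_comp_of_involutive {ι M : Type*} [AddCommMonoid M] (s : Finset ι)
    {σ : ι → ι} (hσ : Function.Involutive σ) (hs : ∀ i ∈ s, σ i ∈ s) (f : ι → M) :
    ∑ i ∈ s, f (σ i) = ∑ i ∈ s, f i :=
  Finset.sum_nbij' σ σ hs hs (fun i _ => hσ i) (fun i _ => hσ i) (fun _ _ => rfl)

/-- If `σ` is an involution of `s`, then the sum over `i ∈ s` of the wedges of `y i + x (σ i)` with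
`x i + y (σ i)` vanishes. -/
theorem sum_wedge_add_eq_zero {ι V : Type*} [AddCommGroup V] [Module ℂ V] (s : Finset ι)
    {σ : ι → ι} (hσ : Function.Involutive σ) (hs : ∀ i ∈ s, σ i ∈ s) (x y : ι → V) :
    ∑ i ∈ s, ((y i + x (σ i)) ⊗ₜ[ℂ] (x i + y (σ i))
      - (x i + y (σ i)) ⊗ₜ[ℂ] (y i + x (σ i))) = 0 := by
  have h₁ := s.sum_comp_of_involutive hσ hs
    (fun i => y i ⊗ₜ[ℂ] x i - x i ⊗ₜ[ℂ] y i)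
  have h₂ := s.sum_comp_of_involutive hσ hs (fun i => y i ⊗ₜ[ℂ] y (σ i))
  have h₃ := s.sum_comp_of_involutive hσ hs (fun i => x i ⊗ₜ[ℂ] x (σ i))
  simp only [hσ _, Finset.sum_sub_distrib] at h₁ h₂ h₃
  simp only [TensorProduct.add_tmul, TensorProduct.tmul_add, Finset.sum_add_distrib,
    Finset.sum_sub_distrib]
  rw [h₂, h₃, sub_eq_iff_eq_add.mp h₁]
  abel

/-- Symmetrizing both slots of a bilinear expression along an involution moves the
symmetrization onto the coefficients. -/
theorem sum_smul_wedge_add {ι V : Type*} [AddCommGroup V] [Module ℂ V] (s : Finset ι)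
    {σ : ι → ι} (hσ : Function.Involutive σ) (hs : ∀ i ∈ s, σ i ∈ s) (c : ι → ι → ℂ)
    (v : ι → V) :
    ∑ a ∈ s, ∑ b ∈ s, c a b • ((v a + v (σ a)) ⊗ₜ[ℂ] (v b + v (σ b))
      - (v b + v (σ b)) ⊗ₜ[ℂ] (v a + v (σ a)))
    = ∑ a ∈ s, ∑ b ∈ s, (c a b + c a (σ b) + c (σ a) b + c (σ a) (σ b)) •
        (v a ⊗ₜ[ℂ] v b - v b ⊗ₜ[ℂ] v a) := by
  let w : ι → ι → V ⊗[ℂ] V := fun a b => v a ⊗ₜ[ℂ] v b - v b ⊗ₜ[ℂ] v a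
  have hr : ∀ d : ι → ι → ℂ, ∑ a ∈ s, ∑ b ∈ s, d a (σ b) • w a b
      = ∑ a ∈ s, ∑ b ∈ s, d a b • w a (σ b) := fun d =>
    Finset.sum_congr rfl fun a _ => by
      simpa only [hσ _] using s.sum_comp_of_involutive hσ hs (fun b => d a b • w a (σ b))
  have hl : ∀ d : ι → ι → ℂ, ∑ a ∈ s, ∑ b ∈ s, d (σ a) b • w a b
      = ∑ a ∈ s, ∑ b ∈ s, d a b • w (σ a) b := fun d => by
    simpa only [hσ _] using
      s.sum_comp_of_involutive hσ hs (fun a => ∑ b ∈ s, d a b • w (σ a) b)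
  have hlr : ∑ a ∈ s, ∑ b ∈ s, c (σ a) (σ b) • w a b
      = ∑ a ∈ s, ∑ b ∈ s, c a b • w (σ a) (σ b) := by
    rw [hr fun a b => c (σ a) b]
    simpa only [hσ _] using
      s.sum_comp_of_involutive hσ hs (fun a => ∑ b ∈ s, c a b • w (σ a) (σ b))
  change _ = ∑ a ∈ s, ∑ b ∈ s, (c a b + c a (σ b) + c (σ a) b + c (σ a) (σ b)) • w a b
  simp only [add_smul, Finset.sum_add_distrib]
  rw [hr, hl, hlr]
  simp only [← Finset.sum_add_distrib, ← smul_add]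
  refine Finset.sum_congr rfl fun a _ => Finset.sum_congr rfl fun b _ => ?_
  simp only [w, TensorProduct.add_tmul, TensorProduct.tmul_add]
  congr 1
  abel

theorem statement13
    {L : Type*} [LieRing L] [LieAlgebra ℂ L] [FiniteDimensional ℂ L]
    [LieAlgebra.IsSimple ℂ L]
    -- `H` is a Cartan subalgebra of the simple complex Lie algebra `L`
    (H : LieSubalgebra ℂ L) [LieSubalgebra.IsCartanSubalgebra H]
    -- `Φ` is the set of roots of `L` relative to `H`
    (Φ : Set (Module.Dual ℂ H))
    (hΦ : ∀ α : Module.Dual ℂ H, α ∈ Φ ↔ α ≠ 0 ∧ rootSpace' H α ≠ ⊥)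
    (hΦneg : ∀ γ ∈ Φ, -γ ∈ Φ)
    -- `hvec lam` is the element `h_lam ∈ H` representing `lam` via the Killing form
    (hvec : Module.Dual ℂ H → H)
    (hhvec : ∀ (lam : Module.Dual ℂ H) (x : H),
      killingForm ℂ L (hvec lam : L) (x : L) = lam x)
    -- root vectors `e α ∈ g_α \ {0}` normalized by `B (e α) (e (-α)) = 1`
    (e : Module.Dual ℂ H → L)
    (he : ∀ α ∈ Φ, e α ∈ rootSpace' H α)
    (he0 : ∀ α ∈ Φ, e α ≠ 0)
    (heB : ∀ α ∈ Φ, killingForm ℂ L (e α) (e (-α)) = 1)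
    (hee : ∀ α ∈ Φ, ⁅e α, e (-α)⁆ = (hvec α : L))
    -- `Δ` is a system of simple roots for `Φ`
    (Δ : Finset (Module.Dual ℂ H)) (hΔΦ : ↑Δ ⊆ Φ)
    (hind : LinearIndependent ℂ (fun b : {x // x ∈ Δ} => (b : Module.Dual ℂ H)))
    (hbase : ∀ γ ∈ Φ, ∃ k : Module.Dual ℂ H → ℤ,
      ((∀ b ∈ Δ, 0 ≤ k b) ∨ (∀ b ∈ Δ, k b ≤ 0)) ∧ γ = ∑ b ∈ Δ, k b • b)
    -- `Φ⁺` is the set of positive roots with respect to `Δ`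
    (Φplus : Finset (Module.Dual ℂ H)) (hΦplusΦ : ↑Φplus ⊆ Φ)
    (hpm : ∀ γ ∈ Φ, (γ ∈ Φplus ∧ -γ ∉ Φplus) ∨ (γ ∉ Φplus ∧ -γ ∈ Φplus))
    (hΦpos : ∀ γ ∈ Φ, (γ ∈ Φplus ↔ ∃ k : Module.Dual ℂ H → ℕ, γ = ∑ b ∈ Δ, k b • b))
    -- `μhat` is the ℤ-linear extension of a diagram automorphism `μ : Δ → Δ` of order 1 or 2
    (μhat : Module.Dual ℂ H → Module.Dual ℂ H)
    (hμadd : ∀ x y, μhat (x + y) = μhat x + μhat y)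
    (hμneg : ∀ x, μhat (-x) = -(μhat x))
    (hμμ : ∀ x, μhat (μhat x) = x)
    (hμΔ : ∀ b ∈ Δ, μhat b ∈ Δ)
    (hμΦ : ∀ γ ∈ Φ, μhat γ ∈ Φ)
    (hμB : ∀ a ∈ Δ, ∀ b ∈ Δ,
      killingForm ℂ L (hvec (μhat a) : L) (hvec (μhat b) : L)
        = killingForm ℂ L (hvec a : L) (hvec b : L))
    -- `θ` is the ℂ-linear involution with `θ (e γ) = -e (-(μ γ))`, `θ (h γ) = -h (μ γ)`
    (θ : L →ₗ[ℂ] L)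
    (hθθ : ∀ x, θ (θ x) = x)
    (hθe : ∀ γ ∈ Φ, θ (e γ) = -(e (-(μhat γ))))
    (hθh : ∀ γ ∈ Φ, θ (hvec γ : L) = -(hvec (μhat γ) : L))
    (t : ℂ) (lam : Module.Dual ℂ H → Module.Dual ℂ H → ℂ)
    (hlam : ∀ a ∈ Δ, ∀ b ∈ Δ, lam a b = (starRingEnd ℂ) (lam (μhat a) (μhat b)))
    (r₀ : L ⊗[ℂ] L)
    (hr₀ : r₀ = (t / 2) •
      ((∑ a ∈ Δ, ∑ b ∈ Δ, lam a b •
          ((hvec a : L) ⊗ₜ[ℂ] (hvec b : L) - (hvec b : L) ⊗ₜ[ℂ] (hvec a : L))) +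
        ∑ a ∈ Φplus, (e (-a) ⊗ₜ[ℂ] e a - e a ⊗ₜ[ℂ] e (-a)))) :
    -- the result, with `t_{a,b} = 2 Re (lam a b + lam a (μ b))`
    TensorProduct.map (LinearMap.id - θ) (LinearMap.id - θ) r₀
      = (t / 2) • ∑ a ∈ Δ, ∑ b ∈ Δ,
          ((2 * (lam a b + lam a (μhat b)).re : ℝ) : ℂ) •
            ((hvec a : L) ⊗ₜ[ℂ] (hvec b : L) - (hvec b : L) ⊗ₜ[ℂ] (hvec a : L)) := by
  have hσ : Function.Involutive μhat := hμμ
  have hμplus : ∀ γ ∈ Φplus, μhat γ ∈ Φplus := by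
    intro γ hγ
    have hγΦ : γ ∈ Φ := hΦplusΦ hγ
    obtain ⟨k, hk⟩ := (hΦpos γ hγΦ).1 hγ
    refine (hΦpos _ (hμΦ γ hγΦ)).2 ⟨fun b => k (μhat b), ?_⟩
    have hM : μhat γ = ∑ b ∈ Δ, k b • μhat b := by
      have := congrArg (AddMonoidHom.mk' μhat hμadd) hk
      simpa only [map_sum, map_nsmul, AddMonoidHom.mk'_apply] using this
    rw [hM, ← Δ.sum_comp_of_involutive hσ hμΔ]
    simp only [hσ _]
  have hPh : ∀ a ∈ Δ, (LinearMap.id - θ : L →ₗ[ℂ] L) (hvec a)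
      = (hvec a : L) + (hvec (μhat a) : L) := fun a ha => by
    simp [hθh a (hΔΦ ha)]
  have hPe : ∀ a ∈ Φplus, (LinearMap.id - θ : L →ₗ[ℂ] L) (e a)
      = e a + e (-(μhat a)) := fun a ha => by
    simp [hθe a (hΦplusΦ ha)]
  have hPe' : ∀ a ∈ Φplus, (LinearMap.id - θ : L →ₗ[ℂ] L) (e (-a))
      = e (-a) + e (μhat a) := fun a ha => by
    simp [hθe (-a) (hΦneg a (hΦplusΦ ha)), hμneg]
  have hroots : ∑ a ∈ Φplus, TensorProduct.map (LinearMap.id - θ) (LinearMap.id - θ)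
      (e (-a) ⊗ₜ[ℂ] e a - e a ⊗ₜ[ℂ] e (-a)) = 0 := by
    rw [← sum_wedge_add_eq_zero Φplus hσ hμplus e (fun a => e (-a))]
    refine Finset.sum_congr rfl fun a ha => ?_
    rw [map_sub, TensorProduct.map_tmul, TensorProduct.map_tmul, hPe a ha, hPe' a ha]
  have hcartan : ∑ a ∈ Δ, ∑ b ∈ Δ, TensorProduct.map (LinearMap.id - θ) (LinearMap.id - θ)
      (lam a b • ((hvec a : L) ⊗ₜ[ℂ] (hvec b : L) - (hvec b : L) ⊗ₜ[ℂ] (hvec a : L)))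
      = ∑ a ∈ Δ, ∑ b ∈ Δ, ((2 * (lam a b + lam a (μhat b)).re : ℝ) : ℂ) •
          ((hvec a : L) ⊗ₜ[ℂ] (hvec b : L) - (hvec b : L) ⊗ₜ[ℂ] (hvec a : L)) := by
    have hsum := sum_smul_wedge_add Δ hσ hμΔ lam (fun a => (hvec a : L))
    refine Eq.trans ?_ (hsum.trans ?_)
    · refine Finset.sum_congr rfl fun a ha => Finset.sum_congr rfl fun b hb => ?_
      rw [map_smul, map_sub, TensorProduct.map_tmul, TensorProduct.map_tmul, hPh a ha, hPh b hb]
    · refine Finset.sum_congr rfl fun a ha => Finset.sum_congr rfl fun b hb => ?_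
      congr 1
      rw [hlam a ha b hb, hlam a ha _ (hμΔ b hb), hσ b]
      refine Complex.ext ?_ ?_
      · simp
        ring
      · simp
  rw [hr₀, map_smul, map_add, map_sum, map_sum, hroots, add_zero, ← hcartan]
  simp only [map_sum]
end

section
/- Let μ be a diagram automorphism of order 1 or 2 extended ℤ-linearly to Φ, let t ∈ ℂ \ {0}, and let t_{α,β} ∈ ℂ (α, β ∈ Δ) satisfy t_{β,α} = −t_{α,β}. Set w = (t/2)·Σ_{α,β ∈ Δ} t_{α,β} (h_α ⊗ h_β − h_β ⊗ h_α) ∈ g ⊗ g, and let k be the ℂ-linear span of {h_α − h_{μ(α)} : α ∈ Φ} ∪ {e_γ − e_{−μ(γ)} : γ ∈ Φ}. Then x·w = 0 (adjoint action of g on g ⊗ g) for all x ∈ k if and only if t_{α,β} = 0 for all α, β ∈ Δ. -/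
open TensorProduct

set_option linter.unusedVariables false

theorem killingForm_eq_zero_of_mem_rootSpace'
    {L : Type*} [LieRing L] [LieAlgebra ℂ L] {H : LieSubalgebra ℂ L}
    {α β : Module.Dual ℂ H} {x y : L} (hx : x ∈ rootSpace' H α) (hy : y ∈ rootSpace' H β)
    (hαβ : α + β ≠ 0) : killingForm ℂ L x y = 0 := by
  obtain ⟨h, hh⟩ : ∃ h, (α + β) h ≠ 0 := by
    by_contra! hc
    exact hαβ (LinearMap.ext hc)
  have key := LieModule.traceForm_apply_lie_apply ℂ L L x (h : L) y
  rw [← lie_skew, hx h, hy h] at key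
  simp only [map_neg, map_smul, LinearMap.neg_apply, LinearMap.smul_apply, smul_eq_mul] at key
  change -(α h * killingForm ℂ L x y) = β h * killingForm ℂ L x y at key
  have : (α + β) h * killingForm ℂ L x y = 0 := by
    rw [LinearMap.add_apply]
    linear_combination -key
  exact (mul_eq_zero.mp this).resolve_left hh

theorem coe_mem_rootSpace'_zero
    {L : Type*} [LieRing L] [LieAlgebra ℂ L] (H : LieSubalgebra ℂ L) [IsLieAbelian H] (h : H) :
    (h : L) ∈ rootSpace' H 0 := by
  intro y
  rw [← LieSubalgebra.coe_bracket, trivial_lie_zero]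
  simp

/-- An element of a Cartan subalgebra on which every root vanishes is zero. -/
theorem eq_zero_of_forall_root_apply_eq_zero
    {L : Type*} [LieRing L] [LieAlgebra ℂ L] [FiniteDimensional ℂ L] [LieAlgebra.IsKilling ℂ L]
    (H : LieSubalgebra ℂ L) [H.IsCartanSubalgebra] {v : H}
    (hv : ∀ α : Module.Dual ℂ H, α ≠ 0 → rootSpace' H α ≠ ⊥ → α v = 0) : v = 0 := by
  rw [← Module.forall_dual_apply_eq_zero_iff ℂ]
  intro f
  have hf : f ∈ Submodule.span ℂ
      ({α : LieModule.Weight ℂ H L | α.IsNonZero}.image (LieModule.Weight.toLinear ℂ H L)) := by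
    rw [LieAlgebra.IsKilling.span_weight_isNonZero_eq_top]
    trivial
  induction hf using Submodule.span_induction with
  | mem f hf =>
    obtain ⟨α, hα, rfl⟩ := hf
    refine hv _ (fun h ↦ hα ?_) ?_
    · exact (LieModule.Weight.coe_toLinear_eq_zero_iff).mp h
    · obtain ⟨x, hx, hx0⟩ := α.exists_ne_zero
      refine (Submodule.ne_bot_iff _).mpr ⟨x, fun y ↦ ?_, hx0⟩
      exact LieAlgebra.IsKilling.lie_eq_smul_of_mem_rootSpace hx y
  | zero => rfl
  | add f g _ _ hf hg => simp [hf, hg]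
  | smul c f _ hf => simp [hf]

/-- The contraction of the first tensor factor by a linear form. -/
noncomputable def contractFirst {V : Type*} [AddCommGroup V] [Module ℂ V] (φ : V →ₗ[ℂ] ℂ) :
    V ⊗[ℂ] V →ₗ[ℂ] V :=
  (TensorProduct.lid ℂ V).toLinearMap ∘ₗ LinearMap.rTensor V φ

@[simp]
theorem contractFirst_tmul {V : Type*} [AddCommGroup V] [Module ℂ V] (φ : V →ₗ[ℂ] ℂ) (x y : V) :
    contractFirst φ (x ⊗ₜ[ℂ] y) = φ x • y := by
  simp [contractFirst]

/-- A linear combination of a linearly independent finite set of linear forms that vanishes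
has zero coefficients. -/
theorem eq_zero_of_sum_smul_eq_zero {V : Type*} [AddCommGroup V] [Module ℂ V] {Δ : Finset V}
    (hind : LinearIndependent ℂ (fun b : {x // x ∈ Δ} => (b : V))) {c : V → ℂ}
    (hc : ∑ b ∈ Δ, c b • b = 0) : ∀ b ∈ Δ, c b = 0 := by
  intro b hb
  refine Fintype.linearIndependent_iff.mp hind (fun b ↦ c b) ?_ ⟨b, hb⟩
  rw [← hc, ← Finset.sum_coe_sort Δ (fun b ↦ c b • b)]

theorem statement14
    {L : Type*} [LieRing L] [LieAlgebra ℂ L] [FiniteDimensional ℂ L]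
    [LieAlgebra.IsSimple ℂ L]
    -- `H` is a Cartan subalgebra of the simple complex Lie algebra `L`
    (H : LieSubalgebra ℂ L) [LieSubalgebra.IsCartanSubalgebra H]
    -- `Φ` is the set of roots of `L` relative to `H`
    (Φ : Set (Module.Dual ℂ H))
    (hΦ : ∀ α : Module.Dual ℂ H, α ∈ Φ ↔ α ≠ 0 ∧ rootSpace' H α ≠ ⊥)
    (hΦneg : ∀ γ ∈ Φ, -γ ∈ Φ)
    -- `hvec lam` is the element `h_lam ∈ H` representing `lam` via the Killing form
    (hvec : Module.Dual ℂ H → H)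
    (hhvec : ∀ (lam : Module.Dual ℂ H) (x : H),
      killingForm ℂ L (hvec lam : L) (x : L) = lam x)
    -- root vectors `e α ∈ g_α \ {0}` normalized by `B (e α) (e (-α)) = 1`
    (e : Module.Dual ℂ H → L)
    (he : ∀ α ∈ Φ, e α ∈ rootSpace' H α)
    (he0 : ∀ α ∈ Φ, e α ≠ 0)
    (heB : ∀ α ∈ Φ, killingForm ℂ L (e α) (e (-α)) = 1)
    (hee : ∀ α ∈ Φ, ⁅e α, e (-α)⁆ = (hvec α : L))
    -- `Δ` is a system of simple roots for `Φ`
    (Δ : Finset (Module.Dual ℂ H)) (hΔΦ : ↑Δ ⊆ Φ)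
    (hind : LinearIndependent ℂ (fun b : {x // x ∈ Δ} => (b : Module.Dual ℂ H)))
    (hbase : ∀ γ ∈ Φ, ∃ k : Module.Dual ℂ H → ℤ,
      ((∀ b ∈ Δ, 0 ≤ k b) ∨ (∀ b ∈ Δ, k b ≤ 0)) ∧ γ = ∑ b ∈ Δ, k b • b)
    -- `μhat` is the ℤ-linear extension of a diagram automorphism `μ : Δ → Δ` of order 1 or 2
    (μhat : Module.Dual ℂ H → Module.Dual ℂ H)
    (hμadd : ∀ x y, μhat (x + y) = μhat x + μhat y)
    (hμneg : ∀ x, μhat (-x) = -(μhat x))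
    (hμμ : ∀ x, μhat (μhat x) = x)
    (hμΔ : ∀ b ∈ Δ, μhat b ∈ Δ)
    (hμΦ : ∀ γ ∈ Φ, μhat γ ∈ Φ)
    (hμB : ∀ a ∈ Δ, ∀ b ∈ Δ,
      killingForm ℂ L (hvec (μhat a) : L) (hvec (μhat b) : L)
        = killingForm ℂ L (hvec a : L) (hvec b : L))
    (t : ℂ) (ht : t ≠ 0)
    (tab : Module.Dual ℂ H → Module.Dual ℂ H → ℂ)
    (hskew : ∀ a ∈ Δ, ∀ b ∈ Δ, tab b a = -(tab a b))
    (w : L ⊗[ℂ] L)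
    (hw : w = (t / 2) • ∑ a ∈ Δ, ∑ b ∈ Δ, tab a b •
        ((hvec a : L) ⊗ₜ[ℂ] (hvec b : L) - (hvec b : L) ⊗ₜ[ℂ] (hvec a : L))) :
    -- `k` annihilates `w` under the adjoint action iff all `tab a b` vanish
    ((∀ x ∈ Submodule.span ℂ
        ({y : L | ∃ α ∈ Φ, y = (hvec α : L) - (hvec (μhat α) : L)} ∪
         {y : L | ∃ γ ∈ Φ, y = e γ - e (-(μhat γ))}),
        ⁅x, w⁆ = 0) ↔
      (∀ a ∈ Δ, ∀ b ∈ Δ, tab a b = 0)) := by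
  have hsum : ∀ c : Module.Dual ℂ H → ℂ, ∑ b ∈ Δ, c b • hvec b = 0 → ∀ b ∈ Δ, c b = 0 := by
    intro c hc
    refine eq_zero_of_sum_smul_eq_zero hind (LinearMap.ext fun x ↦ ?_)
    have := congrArg (fun v : H ↦ killingForm ℂ L (v : L) (x : L)) hc
    simpa [hhvec] using this
  constructor
  · intro hk
    have hnz : ∀ γ ∈ Δ, γ + μhat γ ≠ 0 := by
      intro γ hγ h0
      classical
      have := eq_zero_of_sum_smul_eq_zero hind
        (c := fun b ↦ (if b = γ then 1 else 0) + (if b = μhat γ then 1 else 0))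
        (by simpa [add_smul, Finset.sum_add_distrib, hγ, hμΔ γ hγ] using h0) γ hγ
      simp only [if_true] at this
      split_ifs at this <;> norm_num at this
    have hcontr : ∀ γ ∈ Δ, ∑ b ∈ Δ, (∑ a ∈ Δ, tab a b * γ (hvec a)) • hvec b = 0 := by
      intro γ hγ
      have hγΦ := hΔΦ hγ
      have hμΦ' := hΦneg _ (hμΦ γ hγΦ)
      set x := e γ - e (-(μhat γ)) with hx
      set φ : L →ₗ[ℂ] ℂ := killingForm ℂ L (e (-γ)) with hφ
      have hφH : ∀ h : H, φ h = 0 := fun h ↦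
        killingForm_eq_zero_of_mem_rootSpace' (he _ (hΦneg _ hγΦ)) (coe_mem_rootSpace'_zero H h)
          (by simpa using ((hΦ γ).mp hγΦ).1)
      have hφγ : φ (e γ) = 1 := by
        have := heB _ (hΦneg _ hγΦ)
        rwa [neg_neg] at this
      have hφμ : φ (e (-(μhat γ))) = 0 :=
        killingForm_eq_zero_of_mem_rootSpace' (he _ (hΦneg _ hγΦ)) (he _ hμΦ')
          (by rw [← neg_add]; exact neg_ne_zero.mpr (hnz γ hγ))
      have hφx : ∀ h : H, φ ⁅x, (h : L)⁆ = -γ h := by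
        intro h
        rw [← lie_skew, hx, lie_sub, he _ hγΦ h, he _ hμΦ' h]
        simp [hφγ, hφμ]
      have hxw : ⁅x, w⁆ = 0 := hk x (Submodule.subset_span (Or.inr ⟨γ, hγΦ, rfl⟩))
      have hF : ∀ a b : H, contractFirst φ ⁅x, (a : L) ⊗ₜ[ℂ] (b : L)⁆ = ((-γ a • b : H) : L) := by
        intro a b
        simp [TensorProduct.LieModule.lie_tmul_right, hφx, hφH]
      have hFw := congrArg (contractFirst φ) hxw
      rw [hw] at hFw
      simp only [lie_smul, lie_sum, lie_sub, map_smul, map_sum, map_sub, hF, map_zero] at hFw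
      have hFw := (smul_eq_zero.mp hFw).resolve_left (by simpa using ht)
      have hH : ∑ a ∈ Δ, ∑ b ∈ Δ,
          tab a b • (-γ (hvec a) • hvec b - -γ (hvec b) • hvec a) = 0 := by
        apply Subtype.ext
        push_cast
        exact hFw
      set S := ∑ b ∈ Δ, (∑ a ∈ Δ, tab a b * γ (hvec a)) • hvec b with hS
      have h1 : ∑ a ∈ Δ, ∑ b ∈ Δ, (tab a b * γ (hvec a)) • hvec b = S := by
        rw [Finset.sum_comm, hS]
        simp only [Finset.sum_smul]
      have h2 : ∑ a ∈ Δ, ∑ b ∈ Δ, (tab a b * γ (hvec b)) • hvec a = -S := by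
        rw [hS, ← Finset.sum_neg_distrib]
        refine Finset.sum_congr rfl fun a ha ↦ ?_
        rw [Finset.sum_smul, ← Finset.sum_neg_distrib]
        refine Finset.sum_congr rfl fun b hb ↦ ?_
        rw [hskew a ha b hb]
        module
      have h3 : -S + -S = 0 := by
        rw [← hH]
        nth_rewrite 2 [← h2]
        rw [← h1, ← Finset.sum_neg_distrib, ← Finset.sum_add_distrib]
        refine Finset.sum_congr rfl fun a _ ↦ ?_
        rw [← Finset.sum_neg_distrib, ← Finset.sum_add_distrib]
        refine Finset.sum_congr rfl fun b _ ↦ ?_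
        module
      rw [← two_smul ℂ (-S)] at h3
      exact neg_eq_zero.mp ((smul_eq_zero.mp h3).resolve_left two_ne_zero)
    have hzero : ∀ b ∈ Δ, ∑ a ∈ Δ, tab a b • hvec a = 0 := by
      intro b hb
      apply eq_zero_of_forall_root_apply_eq_zero H
      have hΔ : ∀ γ ∈ Δ, γ (∑ a ∈ Δ, tab a b • hvec a) = 0 := by
        intro γ hγ
        simpa using hsum _ (hcontr γ hγ) b hb
      intro α h0 hα
      obtain ⟨k, -, hk⟩ := hbase α ((hΦ α).mpr ⟨h0, hα⟩)
      rw [hk, LinearMap.sum_apply]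
      refine Finset.sum_eq_zero fun γ hγ ↦ ?_
      rw [LinearMap.smul_apply, hΔ γ hγ, smul_zero]
    exact fun a ha b hb ↦ hsum _ (hzero b hb) a ha
  · intro h0 x _
    have : w = 0 := by
      rw [hw, Finset.sum_eq_zero fun a ha ↦ Finset.sum_eq_zero fun b hb ↦ ?_, smul_zero]
      rw [h0 a ha b hb, zero_smul]
    rw [this, lie_zero]
end
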